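/- arXiv:2509.24802 — 2 statements merged into one kernel-verified Lean document; each statement's English description precedes it below -/
import Mathlib

section
/- Let X = ((b_1,d_1), …, (b_n,d_n)) be a finite persistence diagram. For every real x and every 1 ≤ k ≤ n, λ_k(x) > 0 if and only if at least k of the open intervals (b_i, d_i) contain x, i.e., the number of indices i with b_i < x < d_i is at least k. -/
/-- The tent function `f_{(b,d)}`: `0` outside `(b,d)`, `x - b` on `(b, (b+d)/2]`,
and `d - x` on `((b+d)/2, d)`. -/
noncomputable def tent (b d x : ℝ) : ℝ :=
  if b < x ∧ x ≤ (b + d) / 2 then x - b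
  else if (b + d) / 2 < x ∧ x < d then d - x
  else 0

/-- The `k`-th persistence landscape of the diagram `X` at `x`. -/
noncomputable def landscape (X : List (ℝ × ℝ)) (k : ℕ) (x : ℝ) : ℝ :=
  ((X.map fun p => tent p.1 p.2 x).insertionSort (· ≥ ·)).getD (k - 1) 0

theorem tent_pos_iff (b d x : ℝ) : 0 < tent b d x ↔ b < x ∧ x < d := by
  unfold tent
  split_ifs with h₁ h₂
  · exact ⟨fun _ => ⟨h₁.1, by linarith [h₁.1, h₁.2]⟩, fun hx => sub_pos.mpr hx.1⟩
  · exact ⟨fun _ => ⟨by linarith [h₂.1], h₂.2⟩, fun hx => sub_pos.mpr hx.2⟩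
  · refine ⟨fun hx => absurd hx (lt_irrefl 0), fun hx => ?_⟩
    rcases le_or_gt x ((b + d) / 2) with hm | hm
    · exact absurd ⟨hx.1, hm⟩ h₁
    · exact absurd ⟨hm, hx.2⟩ h₂

theorem getD_pos_iff_lt_countP_of_pairwise_ge {l : List ℝ} (hl : l.Pairwise (· ≥ ·)) (n : ℕ) :
    0 < l.getD n 0 ↔ n < l.countP (fun y => decide (0 < y)) := by
  induction l generalizing n with
  | nil => simp
  | cons a l ih =>
    obtain ⟨ha, hl⟩ := List.pairwise_cons.mp hl
    by_cases h : 0 < a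
    · cases n with
      | zero => simp [h]
      | succ n => simpa [List.countP_cons, h] using ih hl n
    · have hz : (a :: l).countP (fun y => decide (0 < y)) = 0 := by
        rw [List.countP_eq_zero]
        intro y hy
        rcases List.mem_cons.mp hy with rfl | hy
        · simpa using h
        · simpa using (ha y hy).trans (not_lt.mp h)
      rw [hz]
      cases n with
      | zero => simpa using h
      | succ n =>
        have hl₀ : l.countP (fun y => decide (0 < y)) = 0 := by
          simpa [List.countP_cons, h] using hz
        simpa [hl₀] using ih hl n

theorem landscape_pos_iff (X : List (ℝ × ℝ)) (hX : ∀ p ∈ X, p.1 ≤ p.2)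
    (x : ℝ) (k : ℕ) (hk1 : 1 ≤ k) (hk2 : k ≤ X.length) :
    0 < landscape X k x ↔
      k ≤ X.countP (fun p => decide (p.1 < x ∧ x < p.2)) := by
  have hsorted := List.pairwise_insertionSort (· ≥ ·) (X.map fun p => tent p.1 p.2 x)
  have hcount : X.countP (fun p => decide (0 < tent p.1 p.2 x)) =
      X.countP (fun p => decide (p.1 < x ∧ x < p.2)) :=
    List.countP_congr fun p _ => by simpa using tent_pos_iff p.1 p.2 x
  rw [landscape, getD_pos_iff_lt_countP_of_pairwise_ge hsorted, (List.perm_insertionSort _ _).countP_eq,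
    List.countP_map, ← hcount]
  simp only [Function.comp_def]
  omega
end

section
/- Let X = ((b_1,d_1), …, (b_n,d_n)) be a finite persistence diagram. The sum of the L¹ norms of all landscape layers equals the sum of squared half-lifetimes: Σ_{k=1}^{n} ∫_ℝ λ_k(x) dx = Σ_{i=1}^{n} ((d_i − b_i)/2)², which equals W(X,2)². -/
open MeasureTheory

theorem tent_eq_max_min (b d x : ℝ) :
    tent b d x = max 0 (min (x - b) (d - x)) := by
  unfold tent
  split_ifs with h₁ h₂
  · rw [min_eq_left (by linarith), max_eq_right (by linarith)]
  · rw [min_eq_right (by linarith), max_eq_right (by linarith)]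
  · refine (max_eq_left ?_).symm
    by_contra! hx
    obtain ⟨hb, hd⟩ := lt_min_iff.mp hx
    rcases le_or_gt x ((b + d) / 2) with hm | hm
    · exact h₁ ⟨by linarith, hm⟩
    · exact h₂ ⟨hm, by linarith⟩

theorem tent_nonneg (b d x : ℝ) : 0 ≤ tent b d x := by
  rw [tent_eq_max_min]
  exact le_max_left _ _

theorem continuous_tent (b d : ℝ) : Continuous (tent b d) := by
  rw [show tent b d = _ from funext (tent_eq_max_min b d)]
  fun_prop

theorem support_tent_subset (b d : ℝ) :
    Function.support (tent b d) ⊆ Set.Ioc b d := by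
  intro x hx
  by_contra hn
  refine hx ?_
  rw [tent_eq_max_min, max_eq_left]
  by_contra! hx
  obtain ⟨hb, hd⟩ := lt_min_iff.mp hx
  exact hn ⟨by linarith, by linarith⟩

theorem integrable_tent (b d : ℝ) : Integrable (tent b d) :=
  (continuous_tent b d).integrable_of_hasCompactSupport <|
    HasCompactSupport.of_support_subset_isCompact isCompact_Icc
      ((support_tent_subset b d).trans Set.Ioc_subset_Icc_self)

theorem integral_tent {b d : ℝ} (h : b ≤ d) : ∫ x, tent b d x = ((d - b) / 2) ^ 2 := by
  have hc := continuous_tent b d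
  rw [← intervalIntegral.integral_eq_integral_of_support_subset (support_tent_subset b d),
    ← intervalIntegral.integral_add_adjacent_intervals
      (hc.intervalIntegrable b ((b + d) / 2)) (hc.intervalIntegrable ((b + d) / 2) d)]
  have h₁ : ∫ x in b..(b + d) / 2, tent b d x = ∫ x in b..(b + d) / 2, (x - b) := by
    refine intervalIntegral.integral_congr fun x hx => ?_
    rw [Set.uIcc_of_le (by linarith)] at hx
    obtain ⟨hb, hm⟩ := hx
    rw [tent_eq_max_min, min_eq_left (by linarith), max_eq_right (by linarith)]
  have h₂ : ∫ x in (b + d) / 2..d, tent b d x = ∫ x in (b + d) / 2..d, (d - x) := by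
    refine intervalIntegral.integral_congr fun x hx => ?_
    rw [Set.uIcc_of_le (by linarith)] at hx
    obtain ⟨hm, hd⟩ := hx
    rw [tent_eq_max_min, min_eq_right (by linarith), max_eq_right (by linarith)]
  rw [h₁, h₂, intervalIntegral.integral_sub (by simp) (by simp),
    intervalIntegral.integral_sub (by simp) (by simp)]
  simp only [integral_id, intervalIntegral.integral_const, smul_eq_mul]
  ring

theorem getD_zero_orderedInsert {a : ℝ} {l : List ℝ} (ha : 0 ≤ a) :
    (l.orderedInsert (· ≥ ·) a).getD 0 0 = max a (l.getD 0 0) := by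
  cases l with
  | nil => simp [ha]
  | cons c l =>
    rw [List.orderedInsert_cons]
    split_ifs with hac
    · simp [hac]
    · simp [(not_le.mp hac).le]

theorem getD_succ_orderedInsert {a : ℝ} (ha : 0 ≤ a) {l : List ℝ}
    (hl : l.Pairwise (· ≥ ·)) (h₀ : ∀ c ∈ l, 0 ≤ c) (j : ℕ) :
    (l.orderedInsert (· ≥ ·) a).getD (j + 1) 0 = max (l.getD (j + 1) 0) (min a (l.getD j 0)) := by
  induction l generalizing j with
  | nil => simp [ha]
  | cons c l ih =>
    obtain ⟨hc, hl⟩ := List.pairwise_cons.mp hl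
    have hc₀ : 0 ≤ c := h₀ c (by simp)
    have hle (i : ℕ) : l.getD i 0 ≤ c := by
      rcases lt_or_ge i l.length with hi | hi
      · rw [List.getD_eq_getElem _ _ hi]
        exact hc _ (List.getElem_mem hi)
      · rwa [List.getD_eq_default _ _ hi]
    rw [List.orderedInsert_cons]
    split_ifs with hac
    · have hsucc : l.getD j 0 ≤ (c :: l).getD j 0 := by
        cases j with
        | zero => simpa using hle 0
        | succ i =>
          rw [List.getD_cons_succ]
          rcases lt_or_ge (i + 1) l.length with hi | hi
          · rw [List.getD_eq_getElem _ _ hi, List.getD_eq_getElem _ _ (by omega)]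
            exact List.pairwise_iff_getElem.mp hl i (i + 1) (by omega) hi (by omega)
          · rw [List.getD_eq_default _ _ hi]
            rcases lt_or_ge i l.length with hi' | hi'
            · rw [List.getD_eq_getElem _ _ hi']
              exact h₀ _ (by simp)
            · rw [List.getD_eq_default _ _ hi']
      have hca : (c :: l).getD j 0 ≤ a := by
        refine le_trans ?_ hac
        cases j with
        | zero => simp
        | succ i => simpa using hle i
      rw [min_eq_right hca, List.getD_cons_succ, List.getD_cons_succ, max_eq_right hsucc]
    · have hac : a ≤ c := (not_le.mp hac).le
      rw [List.getD_cons_succ, List.getD_cons_succ]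
      cases j with
      | zero =>
        rw [getD_zero_orderedInsert ha, List.getD_cons_zero, min_eq_left hac, max_comm]
      | succ i =>
        rw [ih hl (fun e he => h₀ e (by simp [he])), List.getD_cons_succ]

theorem sum_range_getD (l : List ℝ) : ∑ k ∈ Finset.range l.length, l.getD k 0 = l.sum := by
  induction l with
  | nil => simp
  | cons a l ih =>
    rw [List.length_cons, Finset.sum_range_succ', List.sum_cons, ← ih, add_comm]
    simp only [List.getD_cons_succ, List.getD_cons_zero]

theorem sum_landscape (X : List (ℝ × ℝ)) (x : ℝ) :
    ∑ k ∈ Finset.range X.length, landscape X (k + 1) x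
      = (X.map fun p => tent p.1 p.2 x).sum := by
  rw [← (List.perm_insertionSort (· ≥ ·) (X.map fun p => tent p.1 p.2 x)).sum_eq,
    ← sum_range_getD]
  simp [landscape]

theorem landscape_cons_one (p : ℝ × ℝ) (X : List (ℝ × ℝ)) (x : ℝ) :
    landscape (p :: X) 1 x = max (tent p.1 p.2 x) (landscape X 1 x) :=
  getD_zero_orderedInsert (tent_nonneg _ _ x)

theorem landscape_cons_succ (p : ℝ × ℝ) (X : List (ℝ × ℝ)) (j : ℕ) (x : ℝ) :
    landscape (p :: X) (j + 2) x
      = max (landscape X (j + 2) x) (min (tent p.1 p.2 x) (landscape X (j + 1) x)) := by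
  refine getD_succ_orderedInsert (tent_nonneg _ _ x)
    (List.pairwise_insertionSort _ _) (fun c hc => ?_) j
  obtain ⟨q, -, rfl⟩ := List.mem_map.mp ((List.mem_insertionSort _).mp hc)
  exact tent_nonneg _ _ x

theorem integrable_landscape (X : List (ℝ × ℝ)) (j : ℕ) :
    Integrable (landscape X (j + 1)) := by
  induction X generalizing j with
  | nil =>
    rw [show landscape [] (j + 1) = fun _ => 0 from funext fun x => by simp [landscape]]
    exact integrable_zero _ _ _
  | cons p X ih =>
    cases j with
    | zero =>
      rw [show landscape (p :: X) (0 + 1) = _ from funext (landscape_cons_one p X)]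
      exact (integrable_tent p.1 p.2).sup (ih 0)
    | succ i =>
      rw [show landscape (p :: X) (i + 1 + 1) = _ from funext (landscape_cons_succ p X i)]
      exact (ih (i + 1)).sup ((integrable_tent p.1 p.2).inf (ih i))

theorem integrable_and_integral_sum_tent {X : List (ℝ × ℝ)} (hX : ∀ p ∈ X, p.1 ≤ p.2) :
    Integrable (fun x => (X.map fun p => tent p.1 p.2 x).sum) ∧
    ∫ x, (X.map fun p => tent p.1 p.2 x).sum
      = (X.map fun p => ((p.2 - p.1) / 2) ^ 2).sum := by
  induction X with
  | nil => simp
  | cons p X ih =>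
    have hp : p.1 ≤ p.2 := hX p (by simp)
    obtain ⟨hi, he⟩ := ih fun q hq => hX q (by simp [hq])
    simp only [List.map_cons, List.sum_cons]
    refine ⟨(integrable_tent p.1 p.2).add hi, ?_⟩
    rw [integral_add (integrable_tent p.1 p.2) hi, integral_tent hp, he]

theorem landscape_L1_sum (X : List (ℝ × ℝ)) (hX : ∀ p ∈ X, p.1 ≤ p.2) :
    (∑ k ∈ Finset.range X.length, ∫ x : ℝ, landscape X (k + 1) x)
      = (X.map fun p => ((p.2 - p.1) / 2) ^ 2).sum ∧
    (X.map fun p => ((p.2 - p.1) / 2) ^ 2).sum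
      = (Real.sqrt ((X.map fun p => ((p.2 - p.1) / 2) ^ 2).sum)) ^ 2 := by
  constructor
  · rw [← integral_finsetSum _ fun k _ => integrable_landscape X k]
    simp only [sum_landscape]
    exact (integrable_and_integral_sum_tent hX).2
  · refine (Real.sq_sqrt (List.sum_nonneg fun y hy => ?_)).symm
    obtain ⟨p, -, rfl⟩ := List.mem_map.mp hy
    positivity
end
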